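/- Let P_ε(ζ) = ζ + ε^l I(ζ) + ε^{l+1} R(ζ,ε) be holomorphic in (ζ, ε), with l ≥ 1 and I not identically zero, on D′ × D_{r₀}(0). Then the m-th iterate satisfies P_ε^m(ζ) = ζ + ε^l m I(ζ) + ε^{l+1} R_m(ζ,ε) for some holomorphic R_m. Consequently, on a closed disc D″ ⊂ D′ centered at 0 containing no zero of I except possibly 0 and for |ε| small enough, the equations I(ζ) + εR(ζ,ε) = 0 and m I(ζ) + ε R_m(ζ,ε) = 0 have the same number of zeros in D″ (counted with multiplicity), namely the number of zeros of I in D″. -/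

import Mathlib

open Metric

/-- `f` has exactly `N` zeros in `s`, counted with multiplicity: `f` factors on `s` as a monic
polynomial with `N` roots (all lying in `s`) times a nonvanishing holomorphic function. -/
def HasNZerosWithMultiplicity (f : ℂ → ℂ) (s : Set ℂ) (N : ℕ) : Prop :=
  ∃ (t : Multiset ℂ) (ψ : ℂ → ℂ), t.card = N ∧ (∀ z ∈ t, z ∈ s) ∧
    DifferentiableOn ℂ ψ s ∧
    ∀ u ∈ s, f u = (t.map (fun z => u - z)).prod * ψ u ∧ ψ u ≠ 0

open Filter Topology Set

/-- The divided difference of a holomorphic function is jointly holomorphic. -/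
theorem differentiableAt_dslope_prod {f : ℂ → ℂ} {U : Set ℂ} (hU : IsOpen U)
    (hf : DifferentiableOn ℂ f U) {a b : ℂ} (ha : a ∈ U) (hb : b ∈ U) :
    DifferentiableAt ℂ (fun p : ℂ × ℂ => dslope f p.1 p.2) (a, b) := by
  have hfd : ∀ z ∈ U, DifferentiableAt ℂ f z := fun z hz => hf.differentiableAt (hU.mem_nhds hz)
  rcases eq_or_ne a b with rfl | hab
  · set c := deriv (deriv f) a with hc
    have hd : HasDerivAt (deriv f) c a :=
      ((DifferentiableOn.deriv hf hU).differentiableAt (hU.mem_nhds ha)).hasDerivAt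
    refine HasFDerivAt.differentiableAt (f' := (c / 2) •
      (ContinuousLinearMap.fst ℂ ℂ ℂ + ContinuousLinearMap.snd ℂ ℂ ℂ))
      (HasFDerivAt.of_isLittleO (Asymptotics.isLittleO_iff.2 fun ε hε => ?_))
    have h1 := Asymptotics.isLittleO_iff.1 (hasDerivAt_iff_isLittleO.1 hd) hε
    obtain ⟨δ, hδ, hball⟩ := Metric.eventually_nhds_iff_ball.1 (h1.and (hU.mem_nhds ha))
    filter_upwards [ball_mem_nhds (a, a) hδ] with p hp
    obtain ⟨x, y⟩ := p
    set s := ‖((x, y) : ℂ × ℂ) - (a, a)‖ with hs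
    have hsδ : s < δ := by simpa [hs, dist_eq_norm] using hp
    have hxs : ‖x - a‖ ≤ s := norm_fst_le (((x, y) : ℂ × ℂ) - (a, a))
    have hys : ‖y - a‖ ≤ s := norm_snd_le (((x, y) : ℂ × ℂ) - (a, a))
    have hsub : ∀ z ∈ closedBall a s, z ∈ ball a δ := fun z hz =>
      lt_of_le_of_lt (mem_closedBall.1 hz) hsδ
    have hder : ∀ z ∈ closedBall a s, ‖deriv f z - deriv f a - c * (z - a)‖ ≤ ε * s := by
      intro z hz
      have h2 := (hball z (hsub z hz)).1
      rw [smul_eq_mul, mul_comm (z - a)] at h2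
      exact h2.trans (by gcongr; simpa [dist_eq_norm] using hz)
    have hx : x ∈ closedBall a s := by simpa [dist_eq_norm] using hxs
    have hy : y ∈ closedBall a s := by simpa [dist_eq_norm] using hys
    simp only [dslope_same, smul_apply, add_apply,
      ContinuousLinearMap.coe_fst', ContinuousLinearMap.coe_snd', Prod.mk_sub_mk, smul_eq_mul]
    change _ ≤ ε * s
    rcases eq_or_ne x y with rfl | hxy
    · rw [dslope_same]
      have h2 : c / 2 * (x - a + (x - a)) = c * (x - a) := by ring
      rw [h2]
      exact hder x hx
    · have key := Convex.norm_image_sub_le_of_norm_hasDerivWithin_le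
        (f := fun z => f z - deriv f a * z - c / 2 * (z - a) ^ 2)
        (f' := fun z => deriv f z - deriv f a - c * (z - a)) (s := closedBall a s)
        (C := ε * s) (x := x) (y := y) (fun z hz => by
          have h3 := (hfd z (hball z (hsub z hz)).2).hasDerivAt
          have h4 := (h3.fun_sub ((hasDerivAt_id' z).const_mul (deriv f a))).fun_sub
            ((((hasDerivAt_id' z).sub_const a).fun_pow 2).const_mul (c / 2))
          refine (h4.congr_deriv ?_).hasDerivWithinAt
          push_cast
          ring) hder (convex_closedBall a s) hx hy
      have hne : y - x ≠ 0 := sub_ne_zero.2 hxy.symm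
      rw [dslope_of_ne _ hxy.symm, slope_def_field]
      refine le_of_mul_le_mul_right (le_trans (le_of_eq ?_) key) (norm_pos_iff.2 hne)
      rw [← norm_mul]
      congr 1
      field_simp
      ring
  · have h1 : (fun p : ℂ × ℂ => dslope f p.1 p.2) =ᶠ[𝓝 (a, b)]
        fun p => (f p.2 - f p.1) / (p.2 - p.1) := by
      filter_upwards [(isOpen_ne_fun continuous_fst continuous_snd).mem_nhds
        (show ((a, b) : ℂ × ℂ).1 ≠ ((a, b) : ℂ × ℂ).2 from hab)] with p hp
      rw [dslope_of_ne _ (Ne.symm hp), slope_def_field]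
    refine DifferentiableAt.congr_of_eventuallyEq ?_ h1
    have h2 : DifferentiableAt ℂ (fun p : ℂ × ℂ => f p.2) (a, b) :=
      (hfd b hb).comp (a, b) differentiableAt_snd
    have h3 : DifferentiableAt ℂ (fun p : ℂ × ℂ => f p.1) (a, b) :=
      (hfd a ha).comp (a, b) differentiableAt_fst
    have h4 : DifferentiableAt ℂ (fun p : ℂ × ℂ => p.2 - p.1) (a, b) := by fun_prop
    exact (h2.sub h3).mul (h4.inv (sub_ne_zero.2 hab.symm))

/-- Near the origin, the iterates of a holomorphic family tangent to the identity to order `k + 1`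
in the parameter have the expected normal form. -/
theorem exists_iterate_normal_form (k m : ℕ) {U V : Set ℂ} (hU : IsOpen U) (hV : IsOpen V)
    (hU0 : (0 : ℂ) ∈ U) (hV0 : (0 : ℂ) ∈ V) {I : ℂ → ℂ} {R : ℂ → ℂ → ℂ}
    (hI : DifferentiableOn ℂ I U)
    (hR : DifferentiableOn ℂ (fun p : ℂ × ℂ => R p.1 p.2) (U ×ˢ V)) {P : ℂ → ℂ → ℂ}
    (hP : ∀ ε ζ : ℂ, P ε ζ = ζ + ε ^ (k + 1) * I ζ + ε ^ (k + 2) * R ζ ε) :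
    ∃ Rm : ℂ → ℂ → ℂ, ∀ᶠ p : ℂ × ℂ in 𝓝 (0, 0),
      DifferentiableAt ℂ (fun p : ℂ × ℂ => Rm p.1 p.2) p ∧
      (P p.2)^[m] p.1 =
        p.1 + p.2 ^ (k + 1) * (m : ℂ) * I p.1 + p.2 ^ (k + 2) * Rm p.1 p.2 := by
  induction m with
  | zero => exact ⟨fun _ _ => 0, by simp⟩
  | succ m ih =>
    obtain ⟨Rm, hRm⟩ := ih
    set W : ℂ × ℂ → ℂ := fun p =>
      p.1 + p.2 ^ (k + 1) * (m : ℂ) * I p.1 + p.2 ^ (k + 2) * Rm p.1 p.2 with hW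
    have hWd : ∀ p : ℂ × ℂ, p.1 ∈ U → DifferentiableAt ℂ (fun p : ℂ × ℂ => Rm p.1 p.2) p →
        DifferentiableAt ℂ W p := by
      intro p hp hd
      have h1 : DifferentiableAt ℂ (fun p : ℂ × ℂ => I p.1) p :=
        (hI.differentiableAt (hU.mem_nhds hp)).comp p differentiableAt_fst
      have h2 : DifferentiableAt ℂ (fun p : ℂ × ℂ => p.2) p := differentiableAt_snd
      exact (differentiableAt_fst.add (((h2.pow (k + 1)).mul_const _).mul h1)).add
        ((h2.pow (k + 2)).mul hd)
    have hW0 : Tendsto W (𝓝 (0, 0)) (𝓝 0) := by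
      have h := (hWd (0, 0) hU0 hRm.self_of_nhds.1).continuousAt.tendsto
      simpa [hW] using h
    refine ⟨fun ζ ε => Rm ζ ε + R (W (ζ, ε)) ε +
      ε ^ k * (m * I ζ + ε * Rm ζ ε) * dslope I ζ (W (ζ, ε)), ?_⟩
    filter_upwards [hRm, hW0.eventually (hU.mem_nhds hU0),
      continuous_fst.continuousAt.eventually (hU.mem_nhds hU0),
      continuous_snd.continuousAt.eventually (hV.mem_nhds hV0)] with p hp hWU hpU hpV
    obtain ⟨hd, hit⟩ := hp
    have hWp := hWd p hpU hd
    constructor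
    · have h1 : DifferentiableAt ℂ (fun p : ℂ × ℂ => I p.1) p :=
        (hI.differentiableAt (hU.mem_nhds hpU)).comp p differentiableAt_fst
      have h2 : DifferentiableAt ℂ (fun p : ℂ × ℂ => R (W p) p.2) p :=
        (hR.differentiableAt ((hU.prod hV).mem_nhds
          (show (W p, p.2) ∈ U ×ˢ V from ⟨hWU, hpV⟩))).comp (f := fun p => (W p, p.2)) p
          (hWp.prodMk differentiableAt_snd)
      have h3 : DifferentiableAt ℂ (fun p : ℂ × ℂ => dslope I p.1 (W p)) p :=
        (differentiableAt_dslope_prod hU hI hpU hWU).comp (f := fun p => (p.1, W p)) p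
          (differentiableAt_fst.prodMk hWp)
      have h4 : DifferentiableAt ℂ (fun p : ℂ × ℂ => p.2) p := differentiableAt_snd
      exact (hd.add h2).add (((h4.pow k).mul ((h1.const_mul _).add (h4.mul hd))).mul h3)
    · have h1 := sub_smul_dslope I p.1 (W p)
      rw [smul_eq_mul] at h1
      have h2 : W p - p.1 = p.2 ^ (k + 1) * (m : ℂ) * I p.1 + p.2 ^ (k + 2) * Rm p.1 p.2 := by
        simp only [hW]; ring
      rw [h2] at h1
      rw [Function.iterate_succ_apply', hit, hP]
      change W p + p.2 ^ (k + 1) * I (W p) + p.2 ^ (k + 2) * R (W p) p.2 = _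
      rw [eq_add_of_sub_eq h1.symm]
      change _ = _ + _ + p.2 ^ (k + 2) * (Rm p.1 p.2 + R (W p) p.2 +
        p.2 ^ k * (m * I p.1 + p.2 * Rm p.1 p.2) * dslope I p.1 (W p))
      generalize dslope I p.1 (W p) = D, R (W p) p.2 = Q
      rw [eq_add_of_sub_eq h2]
      push_cast
      ring

/-- A function holomorphic on a preconnected open set and not identically zero there factors as a
monic polynomial times a holomorphic function that does not vanish on `K`, as soon as its zeros in
`K` are contained in a finite set. -/
theorem exists_eq_prod_mul_of_zeros_subset {U K : Set ℂ} (hU : IsOpen U) (hUc : IsPreconnected U)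
    (hKU : K ⊆ U) (Z : Finset ℂ) :
    ∀ f : ℂ → ℂ, DifferentiableOn ℂ f U → (∃ x ∈ U, f x ≠ 0) →
      (∀ z ∈ K, f z = 0 → z ∈ Z) →
      ∃ (t : Multiset ℂ) (ψ : ℂ → ℂ), (∀ z ∈ t, z ∈ K) ∧ DifferentiableOn ℂ ψ U ∧
        (∀ u ∈ U, f u = (t.map (fun z => u - z)).prod * ψ u) ∧ ∀ u ∈ K, ψ u ≠ 0 := by
  induction Z using Finset.induction_on with
  | empty =>
    intro f hf _ hZ
    exact ⟨0, f, by simp, hf, by simp, fun u hu h => by simpa using hZ u hu h⟩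
  | insert a Z _ ih =>
    intro f hf hne hZ
    by_cases haK : a ∈ K
    swap
    · refine ih f hf hne fun z hz h => (Finset.mem_insert.1 (hZ z hz h)).resolve_left ?_
      rintro rfl
      exact haK hz
    have hfa := hf.analyticOnNhd hU
    have haU := hKU haK
    obtain ⟨x, hxU, hx⟩ := hne
    obtain ⟨n, g, hg, hga, hfg⟩ := (hfa a haU).exists_eventuallyEq_pow_smul_nonzero_iff.2
      fun h => hx (hfa.eqOn_zero_of_preconnected_of_eventuallyEq_zero hUc haU h hxU)
    simp only [smul_eq_mul] at hfg
    set G : ℂ → ℂ := Function.update (fun u => f u / (u - a) ^ n) a (g a) with hG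
    have hGa : G a = g a := by simp [hG]
    have hGne : ∀ u, u ≠ a → G u = f u / (u - a) ^ n := fun u hu => by simp [hG, hu]
    have hfG : ∀ u, f u = (u - a) ^ n * G u := by
      intro u
      rcases eq_or_ne u a with rfl | hu
      · rw [hGa]; exact hfg.self_of_nhds
      · have := sub_ne_zero.2 hu
        rw [hGne u hu]; field_simp
    have hGd : DifferentiableOn ℂ G U := by
      intro u hu
      refine DifferentiableAt.differentiableWithinAt ?_
      rcases eq_or_ne u a with rfl | hua
      · refine hg.differentiableAt.congr_of_eventuallyEq ?_
        filter_upwards [hfg] with z hz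
        rcases eq_or_ne z u with rfl | hzu
        · exact hGa
        · have := sub_ne_zero.2 hzu
          rw [hGne z hzu, hz]; field_simp
      · have h1 : G =ᶠ[𝓝 u] fun u => f u / (u - a) ^ n := by
          filter_upwards [isOpen_ne.mem_nhds hua] with z hz using hGne z hz
        refine DifferentiableAt.congr_of_eventuallyEq ?_ h1
        exact (hf.differentiableAt (hU.mem_nhds hu)).fun_div (by fun_prop)
          (pow_ne_zero _ (sub_ne_zero.2 hua))
    obtain ⟨t, ψ, ht, hψ, hprod, hψ0⟩ := ih G hGd
      ⟨x, hxU, fun h => hx (by rw [hfG, h, mul_zero])⟩ (fun z hz h => by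
        refine (Finset.mem_insert.1 (hZ z hz (by rw [hfG, h, mul_zero]))).resolve_left ?_
        rintro rfl
        exact hga (hGa ▸ h))
    refine ⟨Multiset.replicate n a + t, ψ, fun z hz => ?_, hψ, fun u hu => ?_, hψ0⟩
    · rcases Multiset.mem_add.1 hz with h | h
      · rw [Multiset.eq_of_mem_replicate h]; exact haK
      · exact ht z h
    · rw [hfG, hprod u hu]
      simp [mul_assoc]

/-- A holomorphic function that is not identically zero has only finitely many zeros in a compact
set. -/
theorem finite_zeros_of_differentiableOn {U K : Set ℂ} (hU : IsOpen U) (hUc : IsPreconnected U)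
    (hKU : K ⊆ U) (hK : IsCompact K) {f : ℂ → ℂ} (hf : DifferentiableOn ℂ f U)
    (hne : ∃ x ∈ U, f x ≠ 0) : {z ∈ K | f z = 0}.Finite := by
  by_contra hinf
  obtain ⟨a, haK, ha⟩ := Set.Infinite.exists_accPt_of_subset_isCompact hinf hK (sep_subset _ _)
  obtain ⟨x, hxU, hx⟩ := hne
  refine hx ((hf.analyticOnNhd hU).eqOn_zero_of_preconnected_of_frequently_eq_zero hUc (hKU haK)
    ((accPt_iff_frequently_nhdsNE.1 ha).mono fun z hz => hz.2) hxU)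

theorem differentiable_multiset_prod_sub (t : Multiset ℂ) :
    Differentiable ℂ fun u : ℂ => (t.map (fun z => u - z)).prod := by
  induction t using Multiset.induction_on with
  | empty => simp
  | cons a t ih =>
    simp only [Multiset.map_cons, Multiset.prod_cons]
    fun_prop

theorem circleIntegral_logDeriv_prod_mul {ρ r : ℝ} (hρ : 0 < ρ) (hr : ρ < r) {ψ : ℂ → ℂ}
    (hψ : DifferentiableOn ℂ ψ (ball 0 r)) (hψ0 : ∀ u ∈ closedBall (0 : ℂ) ρ, ψ u ≠ 0)
    (t : Multiset ℂ) (ht : ∀ z ∈ t, z ∈ ball (0 : ℂ) ρ) :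
    CircleIntegrable (logDeriv fun u => (t.map (fun z => u - z)).prod * ψ u) 0 ρ ∧
    (∮ z in C(0, ρ), logDeriv (fun u => (t.map (fun z => u - z)).prod * ψ u) z) =
      t.card * (2 * Real.pi * Complex.I) := by
  have hsub := closedBall_subset_ball (x := (0 : ℂ)) hr
  induction t using Multiset.induction_on with
  | empty =>
    have hc : DifferentiableOn ℂ (logDeriv ψ) (closedBall 0 ρ) :=
      ((hψ.deriv isOpen_ball).mono hsub).div (hψ.mono hsub) hψ0
    simp only [Multiset.map_zero, Multiset.prod_zero, one_mul, Multiset.card_zero, Nat.cast_zero,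
      zero_mul]
    refine ⟨(hc.continuousOn.mono sphere_subset_closedBall).circleIntegrable hρ.le,
      Complex.circleIntegral_eq_zero_of_differentiable_on_off_countable hρ.le
      countable_empty hc.continuousOn fun z hz => ?_⟩
    exact hc.differentiableAt (closedBall_mem_nhds_of_mem hz.1)
  | cons a t ih =>
    obtain ⟨hint, hval⟩ := ih fun z hz => ht z (Multiset.mem_cons_of_mem hz)
    have ha := ht a (Multiset.mem_cons_self a t)
    set F : ℂ → ℂ := fun u => (t.map (fun z => u - z)).prod * ψ u with hF
    have heq : EqOn (logDeriv fun u => ((a ::ₘ t).map (fun z => u - z)).prod * ψ u)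
        (fun z => (z - a)⁻¹ + logDeriv F z) (sphere 0 ρ) := by
      intro z hz
      have hz' : ∀ w ∈ ball (0 : ℂ) ρ, z - w ≠ 0 := by
        intro w hw h
        rw [sub_eq_zero.1 h] at hz
        exact absurd (mem_sphere.1 hz) (mem_ball.1 hw).ne
      have h1 : (fun u => ((a ::ₘ t).map (fun z => u - z)).prod * ψ u) =
          fun u => (u - a) * F u := by
        funext u; simp [hF, mul_assoc]
      have hFz : F z ≠ 0 := by
        refine mul_ne_zero (Multiset.prod_ne_zero ?_) (hψ0 z (sphere_subset_closedBall hz))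
        simp only [Multiset.mem_map, not_exists, not_and]
        exact fun w hw => hz' w (ht w (Multiset.mem_cons_of_mem hw))
      have hFd : DifferentiableAt ℂ F z := (differentiable_multiset_prod_sub t z).mul
        (hψ.differentiableAt (isOpen_ball.mem_nhds (hsub (sphere_subset_closedBall hz))))
      rw [h1, logDeriv_mul z (hz' a ha) hFz (by fun_prop) hFd]
      simp [logDeriv_apply]
    have hia : CircleIntegrable (fun z => (z - a)⁻¹) 0 ρ := by
      refine circleIntegrable_sub_inv_iff.2 (Or.inr fun h => ?_)
      rw [abs_of_pos hρ] at h
      exact absurd (mem_sphere.1 h) (mem_ball.1 ha).ne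
    constructor
    · refine (circleIntegrable_congr ?_).2 (hia.add hint)
      rwa [abs_of_pos hρ]
    · rw [circleIntegral.integral_congr hρ.le heq, circleIntegral.integral_add hia hint, hval,
        circleIntegral.integral_sub_inv_of_mem_ball ha]
      simp
      ring

/-- The argument principle on a disc centered at the origin. -/
theorem exists_hasNZerosWithMultiplicity {ρ r : ℝ} (hρ : 0 < ρ) (hr : ρ < r) {f : ℂ → ℂ}
    (hf : DifferentiableOn ℂ f (ball 0 r)) (hf0 : ∀ u ∈ sphere (0 : ℂ) ρ, f u ≠ 0) :
    ∃ N : ℕ, HasNZerosWithMultiplicity f (closedBall 0 ρ) N ∧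
      (∮ z in C(0, ρ), logDeriv f z) = N * (2 * Real.pi * Complex.I) := by
  have hsub := closedBall_subset_ball (x := (0 : ℂ)) hr
  have hUc : IsPreconnected (ball (0 : ℂ) r) := (convex_ball 0 r).isPreconnected
  have hne : ∃ x ∈ ball (0 : ℂ) r, f x ≠ 0 := by
    have hmem : (ρ : ℂ) ∈ sphere (0 : ℂ) ρ := by simp [abs_of_pos hρ]
    exact ⟨ρ, hsub (sphere_subset_closedBall hmem), hf0 _ hmem⟩
  have hfin := finite_zeros_of_differentiableOn isOpen_ball hUc hsub
    (isCompact_closedBall 0 ρ) hf hne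
  obtain ⟨t, ψ, ht, hψ, hprod, hψ0⟩ := exists_eq_prod_mul_of_zeros_subset isOpen_ball hUc hsub
    hfin.toFinset f hf hne fun z hz h => by simpa using ⟨by simpa using hz, h⟩
  have ht' : ∀ z ∈ t, z ∈ ball (0 : ℂ) ρ := by
    intro z hz
    refine lt_of_le_of_ne (mem_closedBall.1 (ht z hz)) fun h => hf0 z h ?_
    rw [hprod z (hsub (ht z hz)), Multiset.prod_eq_zero, zero_mul]
    exact Multiset.mem_map.2 ⟨z, hz, sub_self z⟩
  refine ⟨t.card, ⟨t, ψ, rfl, ht, hψ.mono hsub, fun u hu => ⟨hprod u (hsub hu), hψ0 u hu⟩⟩, ?_⟩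
  rw [← (circleIntegral_logDeriv_prod_mul hρ hr hψ hψ0 t ht').2]
  refine circleIntegral.integral_congr hρ.le fun z hz => ?_
  have hev : f =ᶠ[𝓝 z] fun u => (t.map (fun z => u - z)).prod * ψ u := by
    filter_upwards [isOpen_ball.mem_nhds (hsub (sphere_subset_closedBall hz))] with u hu
      using hprod u hu
  simp only [logDeriv_apply, hev.deriv_eq, hev.self_of_nhds]

/-- **Rouché's theorem** for logarithmic integrals. -/
theorem circleIntegral_logDeriv_eq_of_norm_sub_lt {ρ r : ℝ} (hρ : 0 < ρ) (hr : ρ < r)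
    {f g : ℂ → ℂ} (hf : DifferentiableOn ℂ f (ball 0 r)) (hg : DifferentiableOn ℂ g (ball 0 r))
    (hfg : ∀ u ∈ sphere (0 : ℂ) ρ, ‖g u - f u‖ < ‖f u‖) :
    (∮ z in C(0, ρ), logDeriv g z) = ∮ z in C(0, ρ), logDeriv f z := by
  have hsub : sphere (0 : ℂ) ρ ⊆ ball 0 r :=
    sphere_subset_closedBall.trans (closedBall_subset_ball hr)
  have hf0 : ∀ u ∈ sphere (0 : ℂ) ρ, f u ≠ 0 := fun u hu =>
    norm_pos_iff.1 ((norm_nonneg _).trans_lt (hfg u hu))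
  have hg0 : ∀ u ∈ sphere (0 : ℂ) ρ, g u ≠ 0 := fun u hu h => by
    simpa [h] using hfg u hu
  have hint : ∀ h : ℂ → ℂ, DifferentiableOn ℂ h (ball 0 r) → (∀ u ∈ sphere (0 : ℂ) ρ, h u ≠ 0) →
      CircleIntegrable (logDeriv h) 0 ρ := fun h hh h0 =>
    (((hh.deriv isOpen_ball).continuousOn.mono hsub).div (hh.continuousOn.mono hsub)
      h0).circleIntegrable hρ.le
  rw [← sub_eq_zero, ← circleIntegral.integral_sub (hint g hg hg0) (hint f hf hf0)]
  refine circleIntegral.integral_eq_zero_of_hasDerivWithinAt (f := fun z => Complex.log (g z / f z))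
    hρ.le fun z hz => HasDerivAt.hasDerivWithinAt ?_
  have hfz := hf0 z hz
  have hgz := hg0 z hz
  have hslit : g z / f z ∈ Complex.slitPlane := by
    have h1 : g z / f z = 1 + (g z - f z) / f z := by field_simp; ring
    rw [h1]
    refine Complex.mem_slitPlane_of_norm_lt_one ?_
    rw [norm_div, div_lt_one (norm_pos_iff.2 hfz)]
    exact hfg z hz
  have hd := ((hg.differentiableAt (isOpen_ball.mem_nhds (hsub hz))).hasDerivAt.fun_div
    (hf.differentiableAt (isOpen_ball.mem_nhds (hsub hz))).hasDerivAt hfz).clog hslit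
  refine hd.congr_deriv ?_
  rw [logDeriv_apply, logDeriv_apply]
  field_simp

/-- A small holomorphic perturbation does not change the number of zeros in a disc whose boundary
carries no zero. -/
theorem exists_forall_norm_lt_hasNZerosWithMultiplicity {ρ r s : ℝ} (hρ : 0 < ρ) (hr : ρ < r)
    (hs : 0 < s) {f : ℂ → ℂ} {S : ℂ → ℂ → ℂ} (hf : DifferentiableOn ℂ f (ball 0 r))
    (hf0 : ∀ u ∈ sphere (0 : ℂ) ρ, f u ≠ 0)
    (hS : DifferentiableOn ℂ (fun p : ℂ × ℂ => S p.1 p.2) (ball 0 r ×ˢ ball 0 s)) {N : ℕ}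
    (hN : (∮ z in C(0, ρ), logDeriv f z) = N * (2 * Real.pi * Complex.I)) :
    ∃ δ > (0 : ℝ), ∀ ε : ℂ, ‖ε‖ < δ →
      HasNZerosWithMultiplicity (fun ζ => f ζ + ε * S ζ ε) (closedBall 0 ρ) N := by
  have hsub : sphere (0 : ℂ) ρ ⊆ ball 0 r :=
    sphere_subset_closedBall.trans (closedBall_subset_ball hr)
  have hsub' : closedBall (0 : ℂ) (s / 2) ⊆ ball 0 s := closedBall_subset_ball (by linarith)
  obtain ⟨C, hC⟩ := ((isCompact_sphere (0 : ℂ) ρ).prod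
    (isCompact_closedBall (0 : ℂ) (s / 2))).exists_bound_of_continuousOn
    (hS.continuousOn.mono (prod_mono hsub hsub'))
  obtain ⟨x, hx, hmin⟩ := (isCompact_sphere (0 : ℂ) ρ).exists_isMinOn
    ⟨(ρ : ℂ), by simp [abs_of_pos hρ]⟩ (hf.continuousOn.mono hsub).norm
  have hx0 : 0 < ‖f x‖ := norm_pos_iff.2 (hf0 x hx)
  have hC0 : 0 < |C| + 1 := by positivity
  refine ⟨min (s / 2) (‖f x‖ / (|C| + 1)), by positivity, fun ε hε => ?_⟩
  obtain ⟨h1, h2⟩ := lt_min_iff.1 hε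
  have hεs : ε ∈ closedBall (0 : ℂ) (s / 2) := by simpa using h1.le
  have hlt : ∀ u ∈ sphere (0 : ℂ) ρ, ‖(f u + ε * S u ε) - f u‖ < ‖f u‖ := by
    intro u hu
    rw [add_sub_cancel_left, norm_mul]
    calc ‖ε‖ * ‖S u ε‖ ≤ ‖ε‖ * (|C| + 1) := by
          gcongr
          have h3 : ‖S u ε‖ ≤ C := hC (u, ε) ⟨hu, hεs⟩
          linarith [le_abs_self C]
      _ < ‖f x‖ := (lt_div_iff₀ hC0).1 h2
      _ ≤ ‖f u‖ := hmin hu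
  have hSε : DifferentiableOn ℂ (fun u => S u ε) (ball 0 r) :=
    hS.comp (f := fun u => (u, ε)) (by fun_prop) fun u hu => ⟨hu, hsub' hεs⟩
  have hg : DifferentiableOn ℂ (fun u => f u + ε * S u ε) (ball 0 r) :=
    hf.add (hSε.const_mul ε)
  obtain ⟨M, hM, hMint⟩ := exists_hasNZerosWithMultiplicity hρ hr hg fun u hu h => by
    have := hlt u hu
    simp [h] at this
  rw [circleIntegral_logDeriv_eq_of_norm_sub_lt hρ hr hf hg hlt, hN] at hMint
  have hNM : N = M := by exact_mod_cast mul_right_cancel₀ Complex.two_pi_I_ne_zero hMint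
  exact hNM ▸ hM

/-- For the family `P_ε(ζ) = ζ + ε^l I(ζ) + ε^{l+1} R(ζ,ε)` (holomorphic, `l ≥ 1`,
`I ≢ 0`), the `m`-th iterate has the form `ζ + ε^l m I(ζ) + ε^{l+1} R_m(ζ,ε)` with `R_m`
holomorphic; consequently, on a closed disc `D″` centered at `0` containing no zero of `I`
except possibly `0`, and for `ε ≠ 0` small enough, the equations `I(ζ) + εR(ζ,ε) = 0` and
`m I(ζ) + ε R_m(ζ,ε) = 0` have the same number of zeros in `D″` counted with multiplicity,
namely the number of zeros of `I` in `D″`. -/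
theorem iterate_normal_form_and_zero_count
    (l m : ℕ) (hl : 1 ≤ l) (hm : 1 ≤ m) (r' r₀ : ℝ) (hr' : 0 < r') (hr₀ : 0 < r₀)
    (I : ℂ → ℂ) (R : ℂ → ℂ → ℂ)
    (hI : DifferentiableOn ℂ I (ball (0:ℂ) r'))
    (hInot : ∃ ζ ∈ ball (0:ℂ) r', I ζ ≠ 0)
    (hR : DifferentiableOn ℂ (fun p : ℂ × ℂ => R p.1 p.2) (ball (0:ℂ) r' ×ˢ ball (0:ℂ) r₀))
    (P : ℂ → ℂ → ℂ)
    (hP : ∀ ε ζ : ℂ, P ε ζ = ζ + ε ^ l * I ζ + ε ^ (l + 1) * R ζ ε) :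
    ∃ (r₁ r₂ : ℝ), 0 < r₁ ∧ r₁ ≤ r' ∧ 0 < r₂ ∧ r₂ ≤ r₀ ∧
      ∃ Rm : ℂ → ℂ → ℂ,
        DifferentiableOn ℂ (fun p : ℂ × ℂ => Rm p.1 p.2)
          (ball (0:ℂ) r₁ ×ˢ ball (0:ℂ) r₂) ∧
        (∀ ζ ∈ ball (0:ℂ) r₁, ∀ ε ∈ ball (0:ℂ) r₂,
          (P ε)^[m] ζ = ζ + ε ^ l * (m : ℂ) * I ζ + ε ^ (l + 1) * Rm ζ ε) ∧
        ∀ ρ : ℝ, 0 < ρ → closedBall (0:ℂ) ρ ⊆ ball (0:ℂ) r₁ →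
          (∀ ζ ∈ closedBall (0:ℂ) ρ, ζ ≠ 0 → I ζ ≠ 0) →
          ∃ N : ℕ, HasNZerosWithMultiplicity I (closedBall (0:ℂ) ρ) N ∧
            ∃ ε₁ > (0:ℝ), ∀ ε : ℂ, ε ≠ 0 → ‖ε‖ < ε₁ →
              HasNZerosWithMultiplicity (fun ζ => I ζ + ε * R ζ ε) (closedBall (0:ℂ) ρ) N ∧
              HasNZerosWithMultiplicity (fun ζ => (m : ℂ) * I ζ + ε * Rm ζ ε)
                (closedBall (0:ℂ) ρ) N := by
  obtain ⟨k, rfl⟩ : ∃ k, l = k + 1 := ⟨l - 1, by omega⟩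
  obtain ⟨Rm, hRm⟩ := exists_iterate_normal_form k m isOpen_ball isOpen_ball
    (mem_ball_self hr') (mem_ball_self hr₀) hI hR hP
  obtain ⟨s, hs, hball⟩ := Metric.eventually_nhds_iff_ball.1 hRm
  have hprod : ∀ ζ ∈ ball (0 : ℂ) (min s r'), ∀ ε ∈ ball (0 : ℂ) (min s r₀),
      ((ζ, ε) : ℂ × ℂ) ∈ ball ((0, 0) : ℂ × ℂ) s := by
    intro ζ hζ ε hε
    rw [← ball_prod_same]
    exact ⟨ball_subset_ball (min_le_left _ _) hζ, ball_subset_ball (min_le_left _ _) hε⟩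
  have hRmd : DifferentiableOn ℂ (fun p : ℂ × ℂ => Rm p.1 p.2)
      (ball (0:ℂ) (min s r') ×ˢ ball (0:ℂ) (min s r₀)) := fun p hp =>
    (hball p (hprod p.1 hp.1 p.2 hp.2)).1.differentiableWithinAt
  refine ⟨min s r', min s r₀, by positivity, min_le_right _ _, by positivity, min_le_right _ _,
    Rm, hRmd, fun ζ hζ ε hε => (hball (ζ, ε) (hprod ζ hζ ε hε)).2, fun ρ hρ hsub h0 => ?_⟩
  have hρr : ρ < min s r' := by
    have h1 : (ρ : ℂ) ∈ ball (0 : ℂ) (min s r') := hsub (by simp [abs_of_pos hρ])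
    rwa [mem_ball_zero_iff, Complex.norm_real, Real.norm_of_nonneg hρ.le] at h1
  have hI0 : ∀ u ∈ sphere (0 : ℂ) ρ, I u ≠ 0 := fun u hu =>
    h0 u (sphere_subset_closedBall hu) (ne_of_mem_sphere hu hρ.ne')
  have hI' : DifferentiableOn ℂ I (ball 0 (min s r')) :=
    hI.mono (ball_subset_ball (min_le_right _ _))
  have hm0 : (m : ℂ) ≠ 0 := Nat.cast_ne_zero.2 (by omega)
  obtain ⟨N, hN, hNint⟩ := exists_hasNZerosWithMultiplicity hρ hρr hI' hI0
  have hmint : (∮ z in C(0, ρ), logDeriv (fun ζ => (m : ℂ) * I ζ) z) =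
      N * (2 * Real.pi * Complex.I) := by
    rw [← hNint]
    refine circleIntegral.integral_congr hρ.le fun z _ => ?_
    exact logDeriv_const_mul z _ hm0
  obtain ⟨δ₁, hδ₁, h1⟩ := exists_forall_norm_lt_hasNZerosWithMultiplicity hρ hρr hr₀ hI' hI0
    (hR.mono (prod_mono (ball_subset_ball (min_le_right _ _)) subset_rfl)) hNint
  obtain ⟨δ₂, hδ₂, h2⟩ := exists_forall_norm_lt_hasNZerosWithMultiplicity hρ hρr
    (lt_min hs hr₀) (hI'.const_mul (m : ℂ)) (fun u hu => mul_ne_zero hm0 (hI0 u hu)) hRmd hmint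
  exact ⟨N, hN, min δ₁ δ₂, lt_min hδ₁ hδ₂, fun ε _ hε =>
    ⟨h1 ε (hε.trans_le (min_le_left _ _)), h2 ε (hε.trans_le (min_le_right _ _))⟩⟩
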